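/- Let q ≥ 3 be a prime power, a, b ∈ F_q with a ≠ 0 and b ≠ 0, and suppose the quadratic x² + x − z, where z = −a/b², has two distinct roots in F_q (this forces b² − 4a ≠ 0). Then for f(x) = a·x + b·x^q + x^(2q−1), ∑_{x ∈ F_{q²}} f(x)^(2 + (q−3)·q) = 3b(1 − a)(b² − a² − 3a)(9a − 6a² + a³ − 2b² + ab²) / (a⁴(b² − 4a)²). -/

import Mathlib

section

open Polynomial

/-- The power sum over `Kˣ` of a polynomial in `x ^ (q - 1)` picks out the coefficients whose
index is divisible by `q + 1`. -/
theorem sum_units_aeval_pow_sub_one {F K : Type*} [Field F] [Field K] [Algebra F K] [Fintype K]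
    [Fintype Kˣ] {q : ℕ} (hq : 2 ≤ q) (hK : Fintype.card K = q ^ 2) (Q : F[X])
    (h₀ : Q.coeff 0 = 0) (hQ : Q.natDegree < 3 * (q + 1)) :
    ∑ x : Kˣ, aeval ((x : K) ^ (q - 1)) Q =
      -algebraMap F K (Q.coeff (q + 1) + Q.coeff (2 * q + 2)) := by
  classical
  have hdvd (i : ℕ) : q ^ 2 - 1 ∣ (q - 1) * i ↔ q + 1 ∣ i := by
    have : q ^ 2 - 1 = (q - 1) * (q + 1) := by
      rw [mul_comm]; simpa using Nat.sq_sub_sq q 1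
    rw [this]
    exact Nat.mul_dvd_mul_iff_left (by omega)
  have hpow (i : ℕ) : ∑ x : Kˣ, (x : K) ^ ((q - 1) * i) = if q + 1 ∣ i then -1 else 0 := by
    have := FiniteField.sum_pow_units K ((q - 1) * i)
    rw [hK] at this
    simp only [hdvd] at this
    convert this
  simp_rw [aeval_eq_sum_range' hQ, Algebra.smul_def]
  rw [Finset.sum_comm]
  simp_rw [← Finset.mul_sum, ← pow_mul, hpow]
  rw [← Finset.sum_subset (s₁ := {0, q + 1, 2 * q + 2})]
  · rw [Finset.sum_insert (by simp), Finset.sum_pair (by omega), h₀,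
      if_pos (dvd_refl (q + 1)), if_pos (show q + 1 ∣ 2 * q + 2 from ⟨2, by ring⟩)]
    simp only [map_zero, map_add]
    ring
  · intro i
    simp only [Finset.mem_insert, Finset.mem_singleton, Finset.mem_range]
    omega
  · intro i hi hi'
    simp only [Finset.mem_insert, Finset.mem_singleton, Finset.mem_range] at hi hi'
    rw [if_neg, mul_zero]
    rintro ⟨k, rfl⟩
    have : k < 3 := by
      by_contra! h
      nlinarith
    interval_cases k <;> omega

theorem coeff_sextic_mul {R : Type*} [CommRing R] (d₀ d₁ d₂ d₃ d₄ d₅ d₆ : R) (W : R[X]) (n : ℕ) :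
    ((C d₀ + C d₁ * X + C d₂ * X ^ 2 + C d₃ * X ^ 3 + C d₄ * X ^ 4 + C d₅ * X ^ 5 +
      C d₆ * X ^ 6) * W).coeff (n + 6) =
      d₀ * W.coeff (n + 6) + d₁ * W.coeff (n + 5) + d₂ * W.coeff (n + 4) + d₃ * W.coeff (n + 3) +
      d₄ * W.coeff (n + 2) + d₅ * W.coeff (n + 1) + d₆ * W.coeff n := by
  simp [add_mul, mul_assoc, coeff_X_pow_mul', coeff_X_mul]

theorem coeff_quadratic_cube_mul {R : Type*} [CommRing R] (a b : R) (W : R[X]) (n : ℕ) :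
    ((C a * X ^ 2 + C b * X + 1) ^ 3 * W).coeff (n + 6) =
      W.coeff (n + 6) + 3 * b * W.coeff (n + 5) + (3 * b ^ 2 + 3 * a) * W.coeff (n + 4) +
      (b ^ 3 + 6 * a * b) * W.coeff (n + 3) + (3 * a * b ^ 2 + 3 * a ^ 2) * W.coeff (n + 2) +
      3 * a ^ 2 * b * W.coeff (n + 1) + a ^ 3 * W.coeff n := by
  have h : (C a * X ^ 2 + C b * X + 1) ^ 3 =
      C 1 + C (3 * b) * X + C (3 * b ^ 2 + 3 * a) * X ^ 2 + C (b ^ 3 + 6 * a * b) * X ^ 3 +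
      C (3 * a * b ^ 2 + 3 * a ^ 2) * X ^ 4 + C (3 * a ^ 2 * b) * X ^ 5 + C (a ^ 3) * X ^ 6 := by
    simp only [map_add, map_mul, map_pow, map_one, map_ofNat]
    ring
  rw [h, coeff_sextic_mul, one_mul]

theorem coeff_quadratic_sq_mul {R : Type*} [CommRing R] (a b : R) (W : R[X]) (n : ℕ) :
    ((X ^ 2 + C b * X + C a) ^ 2 * W).coeff (n + 4) =
      a ^ 2 * W.coeff (n + 4) + 2 * a * b * W.coeff (n + 3) + (b ^ 2 + 2 * a) * W.coeff (n + 2) +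
      2 * b * W.coeff (n + 1) + W.coeff n := by
  have h : (X ^ 2 + C b * X + C a) ^ 2 =
      C (a ^ 2) + C (2 * a * b) * X + C (b ^ 2 + 2 * a) * X ^ 2 + C (2 * b) * X ^ 3 + X ^ 4 := by
    simp only [map_add, map_mul, map_pow, map_ofNat]
    ring
  rw [h]
  generalize a ^ 2 = d₀
  generalize b ^ 2 + 2 * a = d₂
  simp [add_mul, mul_assoc, coeff_X_pow_mul', coeff_X_mul]

theorem quadratic_pow_card {F : Type*} [Field F] [Fintype F] {q : ℕ}
    (hF : Fintype.card F = q) (a b : F) :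
    (C a * X ^ 2 + C b * X + 1) ^ q = C a * (X ^ q) ^ 2 + C b * X ^ q + (1 : F[X]) := by
  have h := FiniteField.expand_card (C a * X ^ 2 + C b * X + 1 : F[X])
  simp only [map_add, map_mul, map_pow, map_one, expand_C, expand_X] at h
  rw [← hF, ← h]

/-- Two Newton steps starting from `X` give `X ^ q` modulo `D ^ 3`, where `D = a X² + b X + 1`
divides `X ^ q - X`, and `c` is the inverse of the discriminant of `D`. -/
theorem quadratic_cube_dvd_X_pow_card_sub {F : Type*} [Field F] [Fintype F] {q : ℕ}
    (hF : Fintype.card F = q) (a b c : F) (hc : c * (b ^ 2 - 4 * a) = 1) (D D' : F[X])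
    (hD : D = C a * X ^ 2 + C b * X + 1) (hD' : D' = 2 * C a * X + C b)
    (hdvd : D ∣ X ^ q - X) (hq : 3 ≤ q) :
    D ^ 3 ∣ X ^ q - (X - C c * D * D' + 3 * C a * C c ^ 2 * D ^ 2 * D') := by
  set N := X - C c * D * D' + 3 * C a * C c ^ 2 * D ^ 2 * D' with hN
  have hc' : C c * (C b ^ 2 - 4 * C a) = (1 : F[X]) := by
    simpa only [map_mul, map_sub, map_pow, map_one, map_ofNat] using congrArg C hc
  have hNewton : C a * N ^ 2 + C b * N + 1 =
      D ^ 3 * (C a ^ 2 * C c ^ 2 * (10 - 15 * C a * C c * D + 36 * C a ^ 2 * C c ^ 2 * D ^ 2)) := by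
    have hD2 : D' ^ 2 = 4 * C a * D + (C b ^ 2 - 4 * C a) := by rw [hD, hD']; ring
    have : C a * N ^ 2 + C b * N + 1 = D * (1 - C c * D' ^ 2 + 3 * C a * C c ^ 2 * D * D' ^ 2 +
        C a * D * D' ^ 2 * C c ^ 2 * (1 - 3 * C a * C c * D) ^ 2) := by
      rw [hN, hD, hD']; ring
    rw [this, hD2]
    linear_combination D * (-1 + C a * C c * D * (3 + (1 - 3 * C a * C c * D) ^ 2)) * hc'
  have hcard := quadratic_pow_card hF a b
  rw [← hD] at hcard
  obtain ⟨k, hk⟩ := hdvd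
  have hcop : IsCoprime (D ^ 3) (C a * (X ^ q + N) + C b) := by
    apply IsCoprime.pow_left
    have : C a * (X ^ q + N) + C b =
        D' + D * (C a * (k - C c * D' + 3 * C a * C c ^ 2 * D * D')) := by
      rw [hN, hD']
      linear_combination C a * hk
    rw [this]
    apply IsCoprime.add_mul_left_right
    refine ⟨-4 * C a * C c, C c * D', ?_⟩
    rw [hD, hD']
    linear_combination hc'
  apply hcop.dvd_of_dvd_mul_right
  have : (X ^ q - N) * (C a * (X ^ q + N) + C b) =
      D ^ q - (C a * N ^ 2 + C b * N + 1) := by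
    rw [hcard]; ring
  rw [this, hNewton]
  exact dvd_sub (pow_dvd_pow _ hq) (dvd_mul_right _ _)

theorem coeff_quadratic_sq_mul_top {F : Type*} [Field F] [Fintype F] {q : ℕ}
    (hF : Fintype.card F = q) (hq : 3 ≤ q) (a b : F) (ha : a ≠ 0) :
    ((X ^ 2 + C b * X + C a) ^ 2 *
        (X ^ 5 * (C a * X ^ 2 + C b * X + 1) ^ (q - 3))).coeff (2 * q + 2) =
      (2 * b - 3 * b / a) / a ^ 2 := by
  set V : F[X] := X ^ 5 * (C a * X ^ 2 + C b * X + 1) ^ (q - 3) with hV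
  have hmul : (C a * X ^ 2 + C b * X + 1) ^ 3 * V =
      X ^ 5 + C b * X ^ (q + 5) + C a * X ^ (2 * q + 5) := by
    have : (C a * X ^ 2 + C b * X + 1) ^ 3 * V =
        X ^ 5 * (C a * X ^ 2 + C b * X + 1) ^ (q - 3 + 3) := by
      rw [hV]; ring
    rw [this, Nat.sub_add_cancel hq, quadratic_pow_card hF]
    ring
  have hdeg : V.natDegree ≤ 2 * q - 1 := by
    have : (C a * X ^ 2 + C b * X + 1 : F[X]).natDegree ≤ 2 := by compute_degree
    calc V.natDegree ≤ 5 + (q - 3) * 2 := by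
          rw [hV]
          exact natDegree_mul_le_of_le (natDegree_X_pow_le 5) (natDegree_pow_le_of_le _ this)
      _ ≤ 2 * q - 1 := by omega
  obtain ⟨n, rfl⟩ : ∃ n, q = n + 3 := ⟨q - 3, by omega⟩
  have hV0 {m : ℕ} (hm : 2 * n + 6 ≤ m) : V.coeff m = 0 :=
    coeff_eq_zero_of_natDegree_lt (by omega)
  have e₁ := congrArg (coeff · (2 * n + 5 + 6)) hmul
  have e₂ := congrArg (coeff · (2 * n + 4 + 6)) hmul
  simp only [coeff_quadratic_cube_mul, coeff_add, coeff_C_mul, coeff_X_pow] at e₁ e₂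
  rw [hV0 (by omega), hV0 (by omega), hV0 (by omega), hV0 (by omega), hV0 (by omega),
    hV0 (by omega), if_neg (by omega), if_neg (by omega), if_pos (by omega)] at e₁
  rw [hV0 (by omega), hV0 (by omega), hV0 (by omega), hV0 (by omega), hV0 (by omega),
    if_neg (by omega), if_neg (by omega), if_neg (by omega)] at e₂
  have h₁ : V.coeff (2 * n + 5) = 1 / a ^ 2 := by
    field_simp
    apply mul_left_cancel₀ ha
    linear_combination e₁
  have h₂ : V.coeff (2 * n + 4) = -3 * b / a ^ 3 := by
    rw [add_assoc (2 * n) 4 1, h₁] at e₂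
    field_simp at e₂ ⊢
    linear_combination e₂
  rw [show 2 * (n + 3) + 2 = 2 * n + 4 + 4 by ring, coeff_quadratic_sq_mul, hV0 (by omega),
    hV0 (by omega), hV0 (by omega), h₁, h₂]
  field_simp
  ring

theorem coeff_quadratic_sq_mul_middle {F : Type*} [Field F] [Fintype F] {q : ℕ}
    (hF : Fintype.card F = q) (hq : 3 ≤ q) (a b c : F) (ha : a ≠ 0)
    (hc : c * (b ^ 2 - 4 * a) = 1) (hdvd : C a * X ^ 2 + C b * X + 1 ∣ (X ^ q - X : F[X])) :
    a ^ 4 * ((X ^ 2 + C b * X + C a) ^ 2 *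
        (X ^ 5 * (C a * X ^ 2 + C b * X + 1) ^ (q - 3))).coeff (q + 1) =
      c ^ 2 * (6 * b ^ 5 - 45 * a * b ^ 3 - 6 * a * b ^ 5 + 81 * a ^ 2 * b + 42 * a ^ 2 * b ^ 3 +
        a ^ 2 * b ^ 5 - 60 * a ^ 3 * b - 5 * a ^ 3 * b ^ 3 - 14 * a ^ 4 * b + 12 * a ^ 5 * b -
        3 * a ^ 6 * b) := by
  set D : F[X] := C a * X ^ 2 + C b * X + 1 with hD
  set D' : F[X] := 2 * C a * X + C b with hD'
  set N := X - C c * D * D' + 3 * C a * C c ^ 2 * D ^ 2 * D' with hN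
  obtain ⟨H, hH⟩ := quadratic_cube_dvd_X_pow_card_sub hF a b c hc D D' hD hD' hdvd hq
  rw [← hN] at hH
  set W : F[X] := X ^ 5 * (D ^ (q - 3) - C a * X ^ q * H) with hW
  have hU : C a * N + C b = C (c ^ 2) * (C (b ^ 5 - 9 * a * b ^ 3 + 23 * a ^ 2 * b) +
      C (30 * a ^ 3) * X + C (30 * a ^ 3 * b) * X ^ 2 + C (10 * a ^ 3 * b ^ 2 +
      20 * a ^ 4) * X ^ 3 +
      C (15 * a ^ 4 * b) * X ^ 4 + C (6 * a ^ 5) * X ^ 5) := by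
    have hc' : C c * (C b ^ 2 - 4 * C a) = (1 : F[X]) := by
      simpa only [map_mul, map_sub, map_pow, map_one, map_ofNat] using congrArg C hc
    rw [hN, hD', hD]
    simp only [map_add, map_sub, map_mul, map_pow, map_ofNat]
    linear_combination -((C a * X + C b) * (1 + C c * (C b ^ 2 - 4 * C a)) - C c * C a *
      (C a * X ^ 2 + C b * X + 1) * (2 * C a * X + C b)) * hc'
  have hmul : D ^ 3 * W = X ^ 5 + X ^ (q + 5) * (C a * N + C b) := by
    have hcard := quadratic_pow_card hF a b
    rw [← hD, ← Nat.sub_add_cancel hq, pow_add, Nat.sub_add_cancel hq] at hcard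
    rw [hW]
    linear_combination X ^ 5 * hcard + C a * X ^ q * X ^ 5 * hH
  have hdegW : W.natDegree ≤ q + 4 := by
    have hD3 : (D ^ 3).natDegree = 6 := by
      have : D.natDegree = 2 := by rw [hD]; compute_degree!
      rw [natDegree_pow, this]
    have hdegU : (C a * N + C b).natDegree ≤ 5 := by
      rw [hU]; compute_degree
    have hdeg : (D ^ 3 * W).natDegree ≤ q + 10 := by
      rw [hmul]
      refine natDegree_add_le_of_degree_le ((natDegree_X_pow_le 5).trans (by omega)) ?_
      exact (natDegree_mul_le_of_le (natDegree_X_pow_le (q + 5)) hdegU).trans (by omega)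
    rcases eq_or_ne W 0 with h | h
    · simp [h]
    · rw [natDegree_mul (by rintro h0; simp [h0] at hD3) h, hD3] at hdeg
      omega
  obtain ⟨n, rfl⟩ : ∃ n, q = n + 3 := ⟨q - 3, by omega⟩
  have hW0 {m : ℕ} (hm : n + 8 ≤ m) : W.coeff m = 0 :=
    coeff_eq_zero_of_natDegree_lt (by omega)
  have hcoeff (i j : ℕ) (hij : i + 6 = j + 8) :
      ((C a * X ^ 2 + C b * X + 1) ^ 3 * W).coeff (n + i + 6) = (C a * N + C b).coeff j := by
    rw [← hD, hmul, show n + i + 6 = j + (n + 3 + 5) by omega, coeff_add, coeff_X_pow,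
      if_neg (by omega), zero_add, coeff_X_pow_mul]
  have hcoeff' (i : ℕ) (hi : i < 2) :
      ((C a * X ^ 2 + C b * X + 1) ^ 3 * W).coeff (n + i + 6) = 0 := by
    rw [← hD, hmul, coeff_add, coeff_X_pow, if_neg (by omega), coeff_X_pow_mul',
      if_neg (by omega), zero_add]
  have e₇ := hcoeff 7 5 rfl
  have e₆ := hcoeff 6 4 rfl
  have e₅ := hcoeff 5 3 rfl
  have e₄ := hcoeff 4 2 rfl
  have e₃ := hcoeff 3 1 rfl
  have e₂ := hcoeff 2 0 rfl
  have e₁ := hcoeff' 1 (by simp)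
  have e₀ := hcoeff' 0 (by simp)
  rw [hU] at e₂ e₃ e₄ e₅ e₆ e₇
  rw [coeff_quadratic_cube_mul] at e₀ e₁ e₂ e₃ e₄ e₅ e₆ e₇
  simp only [coeff_C_mul, coeff_add, coeff_C, coeff_X, coeff_X_pow,
    add_assoc, Nat.reduceAdd, Nat.reduceEqDiff, if_true, if_false] at e₀ e₁ e₂ e₃ e₄ e₅ e₆ e₇
  have ha3 : a ^ 3 ≠ 0 := pow_ne_zero 3 ha
  simp only [hW0, Nat.add_le_add_iff_left, Nat.reduceLeDiff] at e₀ e₁ e₂ e₃ e₄ e₅ e₆ e₇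
  have w₇ : W.coeff (n + 7) = c ^ 2 * (6 * a ^ 2) := by
    apply mul_left_cancel₀ ha3
    linear_combination e₇
  have w₆ : W.coeff (n + 6) = c ^ 2 * (-3 * a * b) := by
    apply mul_left_cancel₀ ha3
    linear_combination e₆ - (3 * a ^ 2 * b) * w₇
  have w₅ : W.coeff (n + 5) = c ^ 2 * (b ^ 2 + 2 * a) := by
    apply mul_left_cancel₀ ha3
    linear_combination e₅ - (3 * a ^ 2 * b) * w₆ - (3 * a * b ^ 2 + 3 * a ^ 2) * w₇
  have w₄ : W.coeff (n + 4) = c ^ 2 * (-3 * b) := by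
    apply mul_left_cancel₀ ha3
    linear_combination e₄ - (3 * a ^ 2 * b) * w₅ - (3 * a * b ^ 2 + 3 * a ^ 2) * w₆ -
      (b ^ 3 + 6 * a * b) * w₇
  have w₃ : W.coeff (n + 3) = c ^ 2 * 6 := by
    apply mul_left_cancel₀ ha3
    linear_combination e₃ - (3 * a ^ 2 * b) * w₄ - (3 * a * b ^ 2 + 3 * a ^ 2) * w₅ -
      (b ^ 3 + 6 * a * b) * w₆ - (3 * b ^ 2 + 3 * a) * w₇
  have w₂ : a ^ 2 * W.coeff (n + 2) = c ^ 2 * (b ^ 3 - 7 * a * b) := by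
    apply mul_left_cancel₀ ha3
    linear_combination a ^ 2 * e₂ - a ^ 2 * (3 * a ^ 2 * b) * w₃ -
      a ^ 2 * (3 * a * b ^ 2 + 3 * a ^ 2) * w₄ - a ^ 2 * (b ^ 3 + 6 * a * b) * w₅ -
      a ^ 2 * (3 * b ^ 2 + 3 * a) * w₆ - a ^ 2 * (3 * b) * w₇
  have w₁ : a ^ 3 * W.coeff (n + 1) = c ^ 2 * (-3 * b ^ 4 + 21 * a * b ^ 2 - 30 * a ^ 2) := by
    apply mul_left_cancel₀ ha3
    linear_combination a ^ 3 * e₁ - a * (3 * a ^ 2 * b) * w₂ -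
      a ^ 3 * (3 * a * b ^ 2 + 3 * a ^ 2) * w₃ - a ^ 3 * (b ^ 3 + 6 * a * b) * w₄ -
      a ^ 3 * (3 * b ^ 2 + 3 * a) * w₅ - a ^ 3 * (3 * b) * w₆ - a ^ 3 * w₇
  have w₀ : a ^ 4 * W.coeff n = c ^ 2 * (6 * b ^ 5 - 45 * a * b ^ 3 + 81 * a ^ 2 * b) := by
    apply mul_left_cancel₀ ha3
    linear_combination a ^ 4 * e₀ - a * (3 * a ^ 2 * b) * w₁ -
      a ^ 2 * (3 * a * b ^ 2 + 3 * a ^ 2) * w₂ - a ^ 4 * (b ^ 3 + 6 * a * b) * w₃ -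
      a ^ 4 * (3 * b ^ 2 + 3 * a) * w₄ - a ^ 4 * (3 * b) * w₅ - a ^ 4 * w₆
  have hsplit : ((X ^ 2 + C b * X + C a) ^ 2 * (X ^ 5 * D ^ (n + 3 - 3))).coeff (n + 3 + 1) =
      ((X ^ 2 + C b * X + C a) ^ 2 * W).coeff (n + 4) := by
    have : (X ^ 2 + C b * X + C a) ^ 2 * (X ^ 5 * D ^ (n + 3 - 3)) =
        (X ^ 2 + C b * X + C a) ^ 2 * W +
          X ^ (n + 3 + 5) * ((X ^ 2 + C b * X + C a) ^ 2 * (C a * H)) := by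
      rw [hW]; ring
    rw [this, coeff_add, coeff_X_pow_mul', if_neg (by omega), add_zero]
  rw [hsplit, coeff_quadratic_sq_mul]
  linear_combination a ^ 6 * w₄ + 2 * a ^ 5 * b * w₃ + a ^ 2 * (b ^ 2 + 2 * a) * w₂ +
    2 * a * b * w₁ + w₀

theorem sum_trinomial_pow_eq_sum_units {F K : Type*} [Field F] [Field K] [Algebra F K]
    [Fintype F] [Fintype K] [Fintype Kˣ] {q : ℕ} (hq : 3 ≤ q)
    (hF : Fintype.card F = q) (hK : Fintype.card K = q ^ 2) (a b : F) :
    ∑ x : K, (algebraMap F K a * x + algebraMap F K b * x ^ q + x ^ (2 * q - 1)) ^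
        (2 + (q - 3) * q) =
      ∑ x : Kˣ, aeval ((x : K) ^ (q - 1)) ((X ^ 2 + C b * X + C a) ^ 2 *
        (X ^ 5 * (C a * X ^ 2 + C b * X + 1) ^ (q - 3))) := by
  classical
  have hfrob (x : K) (y : K) : (x + y) ^ q = x ^ q + y ^ q := by
    have := map_add (FiniteField.frobeniusAlgHom F K) x y
    simpa [FiniteField.frobeniusAlgHom_apply, hF] using this
  have hfix (c : F) : algebraMap F K c ^ q = algebraMap F K c := by
    rw [← map_pow, ← hF, FiniteField.pow_card]
  have h0 : (algebraMap F K a * 0 + algebraMap F K b * 0 ^ q + 0 ^ (2 * q - 1)) ^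
      (2 + (q - 3) * q) = 0 := by
    rw [zero_pow (by omega), zero_pow (by omega)]
    simp
  rw [← Fintype.sum_subtype_add_sum_subtype (· ≠ (0 : K))]
  have hz : ∑ x : {x : K // ¬ x ≠ 0}, (algebraMap F K a * (x : K) + algebraMap F K b * (x : K) ^ q +
      (x : K) ^ (2 * q - 1)) ^ (2 + (q - 3) * q) = 0 := by
    apply Finset.sum_eq_zero
    rintro ⟨x, hx⟩ -
    obtain rfl := not_not.1 hx
    exact h0
  rw [hz, add_zero, ← Equiv.sum_comp unitsEquivNeZero]
  refine Finset.sum_congr rfl fun u _ => ?_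
  simp only [unitsEquivNeZero_apply_coe]
  obtain ⟨x, hx⟩ : ∃ x : K, x = u := ⟨_, rfl⟩
  have hx0 : x ≠ 0 := hx ▸ u.ne_zero
  rw [← hx]
  obtain ⟨n, rfl⟩ : ∃ n, q = n + 3 := ⟨q - 3, by omega⟩
  set y := x ^ (n + 3 - 1) with hy
  have hxy : x ^ (n + 3) = x * y := by rw [hy]; simp; ring
  have hf : algebraMap F K a * x + algebraMap F K b * x ^ (n + 3) + x ^ (2 * (n + 3) - 1) =
      x * (y ^ 2 + algebraMap F K b * y + algebraMap F K a) := by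
    have : x ^ (2 * (n + 3) - 1) = x * y ^ 2 := by
      rw [hy, ← pow_mul, ← pow_succ']
      congr 1
      omega
    rw [this, hxy]; ring
  have hx1 : x ^ ((n + 3) ^ 2 - 1) = 1 := by
    rw [← hK]; exact FiniteField.pow_card_sub_one_eq_one x hx0
  have hy1 : y ^ (n + 4) = 1 := by
    rw [hy, ← pow_mul, ← hx1]
    congr 1
    have : (n + 3) ^ 2 = (n + 2) * (n + 4) + 1 := by ring
    rw [this]; rfl
  have hE : y ^ 2 * (y ^ 2 + algebraMap F K b * y + algebraMap F K a) ^ (n + 3) =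
      algebraMap F K a * y ^ 2 + algebraMap F K b * y + 1 := by
    rw [hfrob, hfrob, mul_pow, hfix, hfix]
    linear_combination (y ^ (n + 4) + 1 + algebraMap F K b * y) * hy1
  rw [hf]
  simp only [map_mul, map_pow, map_add, map_one, aeval_X, aeval_C, Nat.add_sub_cancel]
  rw [← hE, pow_add, mul_comm n, pow_mul, mul_pow x _ (n + 3), hxy]
  have hxn : x ^ 2 * (x * y) ^ n = y ^ 5 * (y ^ 2) ^ n := by
    calc x ^ 2 * (x * y) ^ n = x ^ (n + 3 - 1) * y ^ n := by
          rw [show n + 3 - 1 = n + 2 by omega]; ring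
      _ = y ^ n * y * y ^ (n + 4) := by rw [← hy, hy1]; ring
      _ = y ^ 5 * (y ^ 2) ^ n := by ring
  generalize (y ^ 2 + algebraMap F K b * y + algebraMap F K a) ^ (n + 3) = Q
  rw [mul_pow _ Q, mul_pow _ Q, mul_pow x]
  linear_combination (y ^ 2 + algebraMap F K b * y + algebraMap F K a) ^ 2 * Q ^ n * hxn

theorem sum_trinomial_pow_eq_coeff {F K : Type*} [Field F] [Field K] [Algebra F K]
    [Fintype F] [Fintype K] {q : ℕ} (hq : 3 ≤ q)
    (hF : Fintype.card F = q) (hK : Fintype.card K = q ^ 2) (a b : F) :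
    ∑ x : K, (algebraMap F K a * x + algebraMap F K b * x ^ q + x ^ (2 * q - 1)) ^
        (2 + (q - 3) * q) =
      -algebraMap F K
        (((X ^ 2 + C b * X + C a) ^ 2 *
            (X ^ 5 * (C a * X ^ 2 + C b * X + 1) ^ (q - 3))).coeff (q + 1) +
          ((X ^ 2 + C b * X + C a) ^ 2 *
            (X ^ 5 * (C a * X ^ 2 + C b * X + 1) ^ (q - 3))).coeff (2 * q + 2)) := by
  classical
  rw [sum_trinomial_pow_eq_sum_units hq hF hK, sum_units_aeval_pow_sub_one (by omega) hK]
  · rw [mul_left_comm, mul_comm, coeff_mul_X_pow', if_neg (by omega)]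
  · have h₁ : (X ^ 2 + C b * X + C a : F[X]).natDegree ≤ 2 := by compute_degree
    have h₂ : (C a * X ^ 2 + C b * X + 1 : F[X]).natDegree ≤ 2 := by compute_degree
    have h₃ := natDegree_mul_le_of_le (natDegree_pow_le_of_le 2 h₁)
      (natDegree_mul_le_of_le (natDegree_X_pow_le 5) (natDegree_pow_le_of_le (q - 3) h₂))
    omega

theorem quadratic_dvd_X_pow_card_sub_X {F : Type*} [Field F] [Fintype F] {q : ℕ}
    (hF : Fintype.card F = q) {α β : F} (hα : α ≠ 0) (hβ : β ≠ 0) (hαβ : α ≠ β) :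
    C (α * β) * X ^ 2 + C (-(α + β)) * X + 1 ∣ (X ^ q - X : F[X]) := by
  have hfac : C (α * β) * X ^ 2 + C (-(α + β)) * X + 1 =
      C (α * β) * ((X - C α⁻¹) * (X - C β⁻¹)) := by
    have h₁ : C α * C α⁻¹ = (1 : F[X]) := by rw [← C_mul, mul_inv_cancel₀ hα, C_1]
    have h₂ : C β * C β⁻¹ = (1 : F[X]) := by rw [← C_mul, mul_inv_cancel₀ hβ, C_1]
    simp only [map_mul, map_add, map_neg]
    linear_combination (C β * X - C β * C β⁻¹) * h₁ + (C α * X - 1) * h₂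
  rw [hfac, (isUnit_C.2 (mul_ne_zero hα hβ).isUnit).mul_left_dvd]
  have hroot (t : F) : X - C t ∣ (X ^ q - X : F[X]) := by
    rw [dvd_iff_isRoot, IsRoot.def, eval_sub, eval_pow, eval_X, ← hF, FiniteField.pow_card,
      sub_self]
  exact (isCoprime_X_sub_C_of_isUnit_sub (sub_ne_zero.2 (inv_injective.ne hαβ)).isUnit).mul_dvd
    (hroot _) (hroot _)

end

/-- For `q ≥ 3` and `f(x) = a·x + b·x^q + x^(2q−1)` with `a, b ∈ F_q^*` such that
`x² + x − z`, `z = −a/b²`, has two distinct roots in `F_q` (which forces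
`b² − 4a ≠ 0`), one has
`∑_{x ∈ F_{q²}} f(x)^{2+(q−3)q}
  = 3b(1−a)(b²−a²−3a)(9a−6a²+a³−2b²+ab²)/(a⁴(b²−4a)²)`. -/
theorem trinomial_power_sum_two_q_sub_three_q
    (q : ℕ) (hq : 3 ≤ q)
    (F K : Type*) [Field F] [Field K] [Algebra F K]
    [Fintype F] [Fintype K]
    (hF : Fintype.card F = q) (hK : Fintype.card K = q ^ 2)
    (a b : F) (ha : a ≠ 0) (hb : b ≠ 0)
    (hroots : ∃ r s : F, r ≠ s ∧
      r ^ 2 + r - (-a / b ^ 2) = 0 ∧ s ^ 2 + s - (-a / b ^ 2) = 0) :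
    ∑ x : K,
      (algebraMap F K a * x + algebraMap F K b * x ^ q + x ^ (2 * q - 1)) ^
        (2 + (q - 3) * q)
      = algebraMap F K
          (3 * b * (1 - a) * (b ^ 2 - a ^ 2 - 3 * a) *
              (9 * a - 6 * a ^ 2 + a ^ 3 - 2 * b ^ 2 + a * b ^ 2) /
            (a ^ 4 * (b ^ 2 - 4 * a) ^ 2)) := by
  obtain ⟨r, s, hrs, hr, hs⟩ := hroots
  have hsum : r + s = -1 := by
    apply mul_left_cancel₀ (sub_ne_zero.2 hrs)
    linear_combination hr - hs
  have hprod : b ^ 2 * (r * s) = a := by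
    have : r * s = a / b ^ 2 := by linear_combination r * hsum - hr
    rw [this]
    field_simp
  have ha' : b * r * (b * s) = a := by linear_combination hprod
  have hb' : -(b * r + b * s) = b := by linear_combination -b * hsum
  have hdisc : b ^ 2 - 4 * a = (b * (r - s)) ^ 2 := by
    linear_combination 4 * ha' - (-(b * r + b * s) + b) * hb'
  have hdisc0 : b ^ 2 - 4 * a ≠ 0 := by
    rw [hdisc]
    exact pow_ne_zero 2 (mul_ne_zero hb (sub_ne_zero.2 hrs))
  have hdvd := quadratic_dvd_X_pow_card_sub_X hF
    (left_ne_zero_of_mul (ha' ▸ ha)) (right_ne_zero_of_mul (ha' ▸ ha))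
    ((mul_right_injective₀ hb).ne hrs)
  rw [ha', hb'] at hdvd
  have hmid := coeff_quadratic_sq_mul_middle hF hq a b (b ^ 2 - 4 * a)⁻¹ ha
    (inv_mul_cancel₀ hdisc0) hdvd
  have htop := coeff_quadratic_sq_mul_top hF hq a b ha
  rw [sum_trinomial_pow_eq_coeff hq hF hK, ← map_neg, htop]
  congr 1
  rw [mul_comm, ← eq_div_iff (pow_ne_zero 4 ha)] at hmid
  rw [hmid]
  field_simp
  ring
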